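/- For every unlabeled unranked tree t with at least 2 nodes and every integer k >= 1, the label-shape entropy satisfies H_k(t) <= 2*H^deg(t) + 2*log2(|t|) + 4. -/

import Mathlib

/-- Last `k` entries of a list. -/
def lastN {α} (k : ℕ) (l : List α) : List α := l.drop (l.length - k)

/-- Generic empirical entropy in per-node form: for each node `e` of `D` we add
`log2 (#{e' | cond e' = cond e} / #{e' | cond e' = cond e ∧ val e' = val e})`.
Grouping nodes by the pair `(cond, val)` recovers the usual form
`∑_z ∑_w m_{z,w} log2 (m_z / m_{z,w})`. -/
noncomputable def entropySum {α β γ : Type*} [DecidableEq β] [DecidableEq γ]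
    (D : List α) (cond : α → β) (val : α → γ) : ℝ :=
  (D.map (fun e => Real.logb 2
    ((D.countP (fun e' => decide (cond e' = cond e)) : ℝ) /
     (D.countP (fun e' => decide (cond e' = cond e ∧ val e' = val e)) : ℝ)))).sum

/-- `k`-label-history given the list of ancestor labels (padded with `box`). -/
def kLabHist {σ} (box : σ) (k : ℕ) (h : List σ) : List σ :=
  lastN k (List.replicate k box ++ h)
-- Unranked ordered labeled trees and forests.
mutual
inductive UTree (σ : Type) where
  | node (a : σ) (children : UForest σ) : UTree σ
inductive UForest (σ : Type) where
  | nil : UForest σ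
  | cons (t : UTree σ) (f : UForest σ) : UForest σ
end

/-- Number of trees in a forest. -/
def UForest.len {σ} : UForest σ → ℕ
  | .nil => 0
  | .cons _ f => 1 + f.len

mutual
/-- List of (label-history, label, degree) triples, one per node. -/
def udata {σ} (hist : List σ) : UTree σ → List (List σ × σ × ℕ)
  | .node a f => (hist, a, f.len) :: fudata (hist ++ [a]) f
/-- Node data of a forest of subtrees rooted at label-history `hist`. -/
def fudata {σ} (hist : List σ) : UForest σ → List (List σ × σ × ℕ)
  | .nil => []
  | .cons t f => udata hist t ++ fudata hist f
end

/-- Number of nodes of an unranked tree. -/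
def sizeU {σ} (t : UTree σ) : ℕ := (udata [] t).length
/-- `k`-th order label entropy `H^ℓ_k` of an unranked tree. -/
noncomputable def HlU {σ} [DecidableEq σ] (box : σ) (k : ℕ) (t : UTree σ) : ℝ :=
  entropySum (udata [] t) (fun e => kLabHist box k e.1) (fun e => e.2.1)

/-- `k`-th order label-degree entropy `H^{ℓ,deg}_k` of an unranked tree. -/
noncomputable def HldU {σ} [DecidableEq σ] (box : σ) (k : ℕ) (t : UTree σ) : ℝ :=
  entropySum (udata [] t) (fun e => (kLabHist box k e.1, e.2.1)) (fun e => e.2.2)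

/-- `k`-th order degree-label entropy `H^{deg,ℓ}_k` of an unranked tree. -/
noncomputable def HdlU {σ} [DecidableEq σ] (box : σ) (k : ℕ) (t : UTree σ) : ℝ :=
  entropySum (udata [] t) (fun e => (kLabHist box k e.1, e.2.2)) (fun e => e.2.1)

/-- Degree entropy `H^deg` of an unranked tree: `∑_i n_i log2(|t|/n_i)`. -/
noncomputable def HdegU {σ} [DecidableEq σ] (t : UTree σ) : ℝ :=
  entropySum (udata [] t) (fun _ => ()) (fun e => e.2.2)
/-- Labeled binary trees: every node has 0 or 2 children. -/
inductive LBT (σ : Type) where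
  | leaf (a : σ) : LBT σ
  | node (a : σ) (l r : LBT σ) : LBT σ

/-- List of (history, label, degree) triples of a binary tree, one per node.
The history records alternately labels and direction bits (`false` = left). -/
def ldata {σ} (hist : List (σ × Bool)) : LBT σ → List (List (σ × Bool) × σ × ℕ)
  | .leaf a => [(hist, a, 0)]
  | .node a l r =>
      (hist, a, 2) :: (ldata (hist ++ [(a, false)]) l ++ ldata (hist ++ [(a, true)]) r)
/-- `k`-history of a node given its full history: the last `k` entries after
padding on the left with `(box, false)`. -/
def kHist {σ} (box : σ) (k : ℕ) (h : List (σ × Bool)) : List (σ × Bool) :=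
  lastN k (List.replicate k (box, false) ++ h)

/-- `k`-th order label-shape entropy of a labeled binary tree. -/
noncomputable def Hls {σ} [DecidableEq σ] (box : σ) (k : ℕ) (t : LBT σ) : ℝ :=
  entropySum (ldata [] t) (fun e => kHist box k e.1) (fun e => e.2)
/-- The first-child next-sibling encoding of a forest: the left child of a node is
its first child, the right child its next sibling; missing children become
`box`-labeled dummy leaves. -/
def fcns {σ} (box : σ) : UForest σ → LBT σ
  | .nil => .leaf box
  | .cons (.node a f) rest => .node a (fcns box f) (fcns box rest)

/-- The fcns encoding of a single unranked tree. -/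
def fcnsT {σ} (box : σ) (t : UTree σ) : LBT σ := fcns box (.cons t .nil)

section helpers

open Finset in
lemma aux_gibbs_sum {ι β γ δ : Type*} [Fintype ι] [DecidableEq β] [DecidableEq γ] [DecidableEq δ]
    (c : ι → β) (v : ι → γ) (g : β → δ) :
    ∑ i, ((#{j | c j = c i} : ℝ) / #{j | c j = c i ∧ v j = v i}) /
      ((#{j | g (c j) = g (c i)} : ℝ) / #{j | g (c j) = g (c i) ∧ v j = v i})
      ≤ Fintype.card ι := by
  have h1 := Finset.sum_comp (s := (Finset.univ : Finset ι)) (fun p : β × γ =>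
    ((#{j | c j = p.1} : ℝ) / #{j | c j = p.1 ∧ v j = p.2}) /
      ((#{j | g (c j) = g p.1} : ℝ) / #{j | g (c j) = g p.1 ∧ v j = p.2})) (fun i => (c i, v i))
  simp only at h1
  rw [h1]
  calc _ ≤ ∑ p ∈ (univ.image c) ×ˢ (univ.image v),
        (#{j | c j = p.1} : ℝ) / #{j | g (c j) = g p.1} * #{j | g (c j) = g p.1 ∧ v j = p.2} := by
        refine (Finset.sum_le_sum ?_).trans
          (Finset.sum_le_sum_of_subset_of_nonneg ?_ ?_)
        · intro p hp
          obtain ⟨i, -, rfl⟩ := Finset.mem_image.1 hp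
          have hpos : (0 : ℝ) < #{j | c j = c i ∧ v j = v i} := by
            have : 0 < #{j | c j = c i ∧ v j = v i} :=
              Finset.card_pos.2 ⟨i, by simp⟩
            exact_mod_cast this
          simp only [Prod.mk.injEq, nsmul_eq_mul]
          apply le_of_eq
          field_simp
        · intro p hp
          obtain ⟨i, -, rfl⟩ := Finset.mem_image.1 hp
          simp
        · intros; positivity
    _ = ∑ z ∈ univ.image c, (#{j | c j = z} : ℝ) := by
        rw [Finset.sum_product]
        refine Finset.sum_congr rfl ?_
        intro z hz
        obtain ⟨i, -, rfl⟩ := Finset.mem_image.1 hz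
        simp only
        rw [← Finset.mul_sum]
        have hpos : (0 : ℝ) < #{j | g (c j) = g (c i)} := by
          have : 0 < #{j | g (c j) = g (c i)} :=
            Finset.card_pos.2 ⟨i, by simp⟩
          exact_mod_cast this
        have h2 := Finset.card_eq_sum_card_fiberwise (s := ({j | g (c j) = g (c i)} : Finset ι))
          (f := v) (t := univ.image v) (by intro x _; simp)
        simp only [Finset.filter_filter] at h2
        rw [← Nat.cast_sum, ← h2]
        field_simp
    _ = Fintype.card ι := by
        have h2 := Finset.card_eq_sum_card_fiberwise (s := (univ : Finset ι))
          (f := c) (t := univ.image c) (by intro x _; simp)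
        rw [← Nat.cast_sum, ← h2, Finset.card_univ]
    _ ≤ _ := le_rfl

lemma aux_countP_get {α : Type*} (D : List α) (p : α → Prop) [DecidablePred p] :
    D.countP (fun e => decide (p e)) = (Finset.univ.filter (fun i : Fin D.length => p (D.get i))).card := by
  induction D with
  | nil => simp
  | cons a D ih =>
    rw [Finset.card_filter] at *
    rw [List.countP_cons, ih]
    simp only [List.length_cons]
    rw [Fin.sum_univ_succ]
    simp only [decide_eq_true_eq, List.get_cons_zero]
    rw [add_comm]
    rfl

lemma aux_sum_get {α : Type*} (D : List α) (f : α → ℝ) :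
    (D.map f).sum = ∑ i : Fin D.length, f (D.get i) := by
  induction D with
  | nil => simp
  | cons a D ih =>
    simp only [List.length_cons]
    rw [Fin.sum_univ_succ, List.map_cons, List.sum_cons, ih]
    simp

lemma aux_coarse {α β γ δ : Type*} [DecidableEq β] [DecidableEq γ] [DecidableEq δ]
    (D : List α) (c : α → β) (v : α → γ) (g : β → δ) :
    entropySum D c v ≤ entropySum D (fun e => g (c e)) v := by
  unfold entropySum
  rw [aux_sum_get, aux_sum_get]
  have h := aux_gibbs_sum (fun i : Fin D.length => c (D.get i)) (fun i => v (D.get i)) g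
  simp only [aux_countP_get D]
  rw [← sub_nonpos, ← Finset.sum_sub_distrib]
  have hl2 : 0 < Real.log 2 := Real.log_pos (by norm_num)
  refine (Finset.sum_le_sum (g := fun i => (1 / Real.log 2) *
    (((((Finset.univ.filter (fun j : Fin D.length => c (D.get j) = c (D.get i))).card : ℝ) /
      (Finset.univ.filter (fun j : Fin D.length => c (D.get j) = c (D.get i) ∧ v (D.get j) = v (D.get i))).card) /
      (((Finset.univ.filter (fun j : Fin D.length => g (c (D.get j)) = g (c (D.get i)))).card : ℝ) /
      (Finset.univ.filter (fun j : Fin D.length => g (c (D.get j)) = g (c (D.get i)) ∧ v (D.get j) = v (D.get i))).card)) - 1)) ?_).trans ?_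
  · intro i _
    have hp : ∀ p : Fin D.length → Prop, ∀ [DecidablePred p], p i →
        (0 : ℝ) < (Finset.univ.filter p).card := by
      intro p _ hpi
      have : 0 < (Finset.univ.filter p).card := Finset.card_pos.2 ⟨i, by simpa using hpi⟩
      exact_mod_cast this
    have h1 := hp (fun j => c (D.get j) = c (D.get i)) rfl
    have h2 := hp (fun j => c (D.get j) = c (D.get i) ∧ v (D.get j) = v (D.get i)) ⟨rfl, rfl⟩
    have h3 := hp (fun j => g (c (D.get j)) = g (c (D.get i))) rfl
    have h4 := hp (fun j => g (c (D.get j)) = g (c (D.get i)) ∧ v (D.get j) = v (D.get i)) ⟨rfl, rfl⟩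
    have h12 := div_pos h1 h2
    have h34 := div_pos h3 h4
    rw [← Real.logb_div h12.ne' h34.ne']
    unfold Real.logb
    rw [div_eq_mul_inv, mul_comm, ← one_div]
    exact mul_le_mul_of_nonneg_left (Real.log_le_sub_one_of_pos (div_pos h12 h34)) (by positivity)
  · rw [← Finset.mul_sum, Finset.sum_sub_distrib]
    have : (∑ i : Fin D.length, (1:ℝ)) = Fintype.card (Fin D.length) := by simp
    rw [this]
    exact mul_nonpos_of_nonneg_of_nonpos (by positivity) (sub_nonpos.2 h)

lemma aux_val_congr {α β γ δ : Type*} [DecidableEq β] [DecidableEq γ] [DecidableEq δ]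
    (D : List α) (c : α → β) (v : α → γ) (w : α → δ)
    (h : ∀ e ∈ D, ∀ e' ∈ D, v e' = v e ↔ w e' = w e) :
    entropySum D c v = entropySum D c w := by
  unfold entropySum
  congr 1
  refine List.map_congr_left ?_
  intro e he
  have : D.countP (fun e' => decide (c e' = c e ∧ v e' = v e))
      = D.countP (fun e' => decide (c e' = c e ∧ w e' = w e)) := by
    refine List.countP_congr ?_
    intro e' he'
    simp [h e he e' he']
  rw [this]

lemma aux_val_mono {α β γ δ : Type*} [DecidableEq β] [DecidableEq γ] [DecidableEq δ]
    (D : List α) (c : α → β) (v : α → γ) (g : γ → δ) :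
    entropySum D c (fun e => g (v e)) ≤ entropySum D c v := by
  unfold entropySum
  refine List.sum_le_sum ?_
  intro e he
  have h0 : 0 < D.countP (fun e' => decide (c e' = c e ∧ v e' = v e)) :=
    List.countP_pos_iff.2 ⟨e, he, by simp⟩
  have h1 : D.countP (fun e' => decide (c e' = c e ∧ v e' = v e)) ≤
      D.countP (fun e' => decide (c e' = c e ∧ g (v e') = g (v e))) :=
    List.countP_mono_left (by intro x _; simp only [decide_eq_true_eq]; rintro ⟨a, b⟩; exact ⟨a, by rw [b]⟩)
  have h2 : 0 < D.countP (fun e' => decide (c e' = c e)) :=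
    List.countP_pos_iff.2 ⟨e, he, by simp⟩
  have h0' : (0:ℝ) < D.countP (fun e' => decide (c e' = c e ∧ v e' = v e)) := by exact_mod_cast h0
  have h1' : (D.countP (fun e' => decide (c e' = c e ∧ v e' = v e)) : ℝ) ≤
      D.countP (fun e' => decide (c e' = c e ∧ g (v e') = g (v e))) := by exact_mod_cast h1
  have h2' : (0:ℝ) < D.countP (fun e' => decide (c e' = c e)) := by exact_mod_cast h2
  refine Real.logb_le_logb_of_le (by norm_num) (div_pos h2' (h0'.trans_le h1')) ?_
  exact div_le_div_of_nonneg_left h2'.le h0' h1'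

lemma aux_sum_bool {α : Type*} (D : List α) (c v : α → Bool) (f : Bool → Bool → ℝ) :
    (D.map (fun e => f (c e) (v e))).sum =
      D.countP (fun e => decide (c e = false ∧ v e = false)) * f false false +
      D.countP (fun e => decide (c e = false ∧ v e = true)) * f false true +
      D.countP (fun e => decide (c e = true ∧ v e = false)) * f true false +
      D.countP (fun e => decide (c e = true ∧ v e = true)) * f true true := by
  induction D with
  | nil => simp
  | cons a D ih =>
    rw [List.map_cons, List.sum_cons, ih]
    simp only [List.countP_cons]
    cases c a <;> cases v a <;> simp <;> ring

lemma aux_count_split {α : Type*} (D : List α) (c v : α → Bool) (b : Bool) :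
    D.countP (fun e => decide (c e = b)) =
      D.countP (fun e => decide (c e = b ∧ v e = false)) +
      D.countP (fun e => decide (c e = b ∧ v e = true)) := by
  induction D with
  | nil => simp
  | cons a D ih =>
    simp only [List.countP_cons, ih]
    cases v a <;> simp <;> split_ifs <;> omega

/-- last direction bit -/
def lastBit {σ} (h : List (σ × Bool)) : Bool := (h.getLast?.map Prod.snd).getD false

lemma aux_lastBit_append {σ} (h : List (σ × Bool)) (a : σ) (b : Bool) :
    lastBit (h ++ [(a, b)]) = b := by simp [lastBit]

lemma aux_lastBit_kHist {σ} (box : σ) (k : ℕ) (hk : 1 ≤ k) (h : List (σ × Bool)) :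
    lastBit (kHist box k h) = lastBit h := by
  unfold lastBit kHist lastN
  rw [List.getLast?_drop]
  rw [if_neg (by simp; omega)]
  rcases List.eq_nil_or_concat h with rfl | ⟨l, x, rfl⟩
  · obtain ⟨k, rfl⟩ : ∃ m, k = m + 1 := ⟨k - 1, by omega⟩
    simp [List.getLast?_replicate]
  · simp [← List.append_assoc]

lemma aux_ldata_deg {σ} (T : LBT σ) : ∀ h, ∀ e ∈ ldata h T, e.2.2 = 0 ∨ e.2.2 = 2 := by
  induction T with
  | leaf a => intro h e he; simp [ldata] at he; simp [he]
  | node a l r ihl ihr =>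
    intro h e he
    simp only [ldata, List.mem_cons, List.mem_append] at he
    rcases he with rfl | he | he
    · simp
    · exact ihl _ _ he
    · exact ihr _ _ he

/-- number of nodes with the given last bit and leaf status -/
def bc (b v : Bool) (D : List (List (Unit × Bool) × Unit × ℕ)) : ℕ :=
  D.countP (fun e => decide (lastBit e.1 = b ∧ decide (e.2.2 = 0) = v))

/-- number of nodes with the given leaf status -/
def uc (v : Bool) (D : List (List Unit × Unit × ℕ)) : ℕ :=
  D.countP (fun e => decide (decide (e.2.2 = 0) = v))

/-- indicator of nonempty forest -/
def ne1 : UForest Unit → ℕ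
  | .nil => 0
  | .cons _ _ => 1

lemma aux_len_eq (F : UForest Unit) : (F.len = 0) ↔ ne1 F = 0 := by
  cases F <;> simp [UForest.len, ne1]

lemma aux_ne1 (F : UForest Unit) : ne1 F = 0 ∨ ne1 F = 1 := by
  cases F <;> simp [ne1]

lemma bc_cons (b v : Bool) (x D) : bc b v (x :: D) =
   bc b v D + if (lastBit x.1 = b ∧ decide (x.2.2 = 0) = v) then 1 else 0 := by
  simp [bc, List.countP_cons]
lemma bc_append (b v : Bool) (D E) : bc b v (D ++ E) = bc b v D + bc b v E := by
  simp [bc]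
lemma uc_cons (v : Bool) (x D) : uc v (x :: D) =
   uc v D + if (decide (x.2.2 = 0) = v) then 1 else 0 := by
  simp [uc, List.countP_cons]
lemma uc_append (v : Bool) (D E) : uc v (D ++ E) = uc v D + uc v E := by
  simp [uc]

lemma aux_counts : ∀ (F : UForest Unit) (h : List (Unit × Bool)) (h' : List Unit),
    bc false true (ldata h (fcns () F)) =
      uc true (fudata h' F) + (if lastBit h then 0 else 1 - ne1 F) ∧
    bc false false (ldata h (fcns () F)) =
      uc false (fudata h' F) + (if lastBit h then 0 else ne1 F) ∧
    bc true true (ldata h (fcns () F)) =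
      uc false (fudata h' F) + (if lastBit h then 1 else ne1 F) ∧
    bc true false (ldata h (fcns () F)) + ne1 F =
      uc true (fudata h' F) + (if lastBit h then ne1 F else 0)
  | .nil, h, h' => by
    simp only [fcns, ldata, fudata, bc, uc, ne1]
    cases hb : lastBit h <;> simp [hb]
  | .cons (.node a f) r, h, h' => by
    have h1 := aux_counts f (h ++ [(a, false)]) (h' ++ [a])
    have h2 := aux_counts r (h ++ [(a, true)]) h'
    simp only [fcns, ldata, fudata, udata, bc_cons, bc_append, uc_cons, uc_append, List.cons_append,
      aux_lastBit_append, aux_len_eq] at *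
    have e1 := aux_ne1 f
    have e2 := aux_ne1 r
    have e3 : ne1 (.cons (.node a f) r) = 1 := rfl
    rw [e3]
    rcases e1 with e1 | e1 <;> rcases e2 with e2 | e2 <;> cases lastBit h <;>
      simp [e1, e2] at * <;> omega

/-- x log x -/
noncomputable def eta (x : ℝ) : ℝ := x * Real.log x

lemma aux_term (x y : ℝ) (hx : 0 ≤ x) (hy : 0 < y) :
    x * Real.logb 2 (y / x) = (x * Real.log y - eta x) / Real.log 2 := by
  rcases hx.eq_or_lt with rfl | hx
  · simp [eta]
  · unfold Real.logb eta
    rw [Real.log_div hy.ne' hx.ne']; ring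

lemma eta_step_ub (x : ℝ) (hx : 0 ≤ x) : eta (x + 1) - eta x ≤ Real.log (x + 1) + 1 := by
  rcases hx.eq_or_lt with rfl | hx
  · simp [eta]
  · unfold eta
    have h1 := Real.log_le_sub_one_of_pos (x := (x + 1) / x) (by positivity)
    rw [Real.log_div (by positivity) hx.ne'] at h1
    have h2 := mul_le_mul_of_nonneg_left h1 hx.le
    have h3 : x * ((x + 1) / x - 1) = 1 := by field_simp; ring
    nlinarith

lemma eta_step_lb (x : ℝ) (hx : 0 < x) : 0 ≤ eta (x + 1) - eta x := by
  unfold eta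
  have h1 : Real.log x ≤ Real.log (x + 1) := Real.log_le_log hx (by linarith)
  have h2 : 0 ≤ Real.log (x + 1) := Real.log_nonneg (by linarith)
  nlinarith

lemma aux_real (l m : ℝ) (hl : 1 ≤ l) (hm : 1 ≤ m) :
    (m + 1) * Real.logb 2 ((m + 1 + l) / (m + 1)) + l * Real.logb 2 ((m + 1 + l) / l) +
    (l - 1) * Real.logb 2 ((l - 1 + (m + 1)) / (l - 1)) +
    (m + 1) * Real.logb 2 ((l - 1 + (m + 1)) / (m + 1)) ≤
    2 * (m * Real.logb 2 ((m + l) / m) + l * Real.logb 2 ((m + l) / l)) +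
      2 * Real.logb 2 (m + l) + 4 := by
  have hl2 : 0 < Real.log 2 := Real.log_pos (by norm_num)
  have hl2' : (0.69 : ℝ) < Real.log 2 := by have := Real.log_two_gt_d9; linarith
  rw [aux_term _ _ (by linarith) (by linarith), aux_term _ _ (by linarith) (by linarith),
    aux_term _ _ (by linarith) (by linarith), aux_term _ _ (by linarith) (by linarith),
    aux_term _ _ (by linarith) (by linarith), aux_term _ _ (by linarith) (by linarith)]
  unfold Real.logb
  have e1 : l - 1 + (m + 1) = m + l := by ring
  have e2 : m + 1 + l = m + l + 1 := by ring
  rw [e1, e2]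
  have k1 := eta_step_ub (m + l) (by linarith)
  have k2 := eta_step_ub (l - 1) (by linarith)
  rw [sub_add_cancel] at k2
  have k3 := eta_step_lb m (by linarith)
  have k4 : Real.log l ≤ Real.log (m + l) := Real.log_le_log (by linarith) (by linarith)
  have k5 : Real.log (m + l + 1) ≤ Real.log 2 + Real.log (m + l) := by
    rw [← Real.log_mul (by norm_num) (by linarith)]
    exact Real.log_le_log (by linarith) (by linarith)
  have r1 : (m + l + 1) * Real.log (m + l + 1) = eta (m + l + 1) := rfl
  have r2 : (m + l) * Real.log (m + l) = eta (m + l) := rfl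
  have : (4:ℝ) = 4 * Real.log 2 / Real.log 2 := by field_simp
  rw [this]
  simp only [← add_div, ← mul_div_assoc]
  rw [div_le_div_iff_of_pos_right hl2]
  nlinarith

end helpers

/-- For every unlabeled (one-letter alphabet) unranked tree `t` with at least 2 nodes and
every `k ≥ 1`, the label-shape entropy `H_k(t) = H_k(fcns(t))` satisfies
`H_k(t) ≤ 2 H^deg(t) + 2 log2 |t| + 4`. -/
theorem Hls_le_two_HdegU (t : UTree Unit) (ht : 2 ≤ sizeU t) (k : ℕ) (hk : 1 ≤ k) :
    Hls () k (fcnsT () t) ≤ 2 * HdegU t + 2 * Real.logb 2 (sizeU t) + 4 := by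
  have H := aux_counts (.cons t .nil) [] []
  have hfu : fudata [] (UForest.cons t .nil) = udata [] t := by simp [fudata]
  rw [hfu] at H
  change bc false true (ldata [] (fcnsT () t)) = _ ∧ bc false false (ldata [] (fcnsT () t)) = _ ∧
    bc true true (ldata [] (fcnsT () t)) = _ ∧ bc true false (ldata [] (fcnsT () t)) + _ = _ at H
  have e0 : lastBit ([] : List (Unit × Bool)) = false := rfl
  have e1 : ne1 (.cons t .nil) = 1 := rfl
  simp only [e0, e1] at H
  simp only [Bool.false_eq_true, if_false, Nat.sub_self, Nat.add_zero] at H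
  obtain ⟨H1, H2, H3, H4⟩ := H
  have U1 : Hls () k (fcnsT () t) ≤ entropySum (ldata [] (fcnsT () t)) (fun e => lastBit e.1)
      (fun e => decide (e.2.2 = 0)) := by
    unfold Hls
    refine (aux_coarse _ _ _ lastBit).trans ?_
    simp only [aux_lastBit_kHist () k hk]
    refine le_of_eq (aux_val_congr _ _ _ _ ?_)
    intro e he e' he'
    have a1 := aux_ldata_deg _ _ e he
    have a2 := aux_ldata_deg _ _ e' he'
    rw [Prod.ext_iff]
    rcases a1 with a1 | a1 <;> rcases a2 with a2 | a2 <;> simp [a1, a2]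
  have U2 : entropySum (udata [] t) (fun _ => false) (fun e => decide (e.2.2 = 0)) ≤ HdegU t := by
    refine (aux_val_mono (udata [] t) (fun _ => false) (fun e => e.2.2) (fun n => decide (n = 0))).trans ?_
    unfold HdegU entropySum
    simp
  generalize hD : ldata [] (fcnsT () t) = D at *
  have S1 : entropySum D (fun e => lastBit e.1) (fun e => decide (e.2.2 = 0)) = _ :=
    aux_sum_bool D (fun e => lastBit e.1) (fun e => decide (e.2.2 = 0)) (fun b v =>
      Real.logb 2 ((D.countP (fun e' => decide (lastBit e'.1 = b)) : ℝ) /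
        (D.countP (fun e' => decide (lastBit e'.1 = b ∧ decide (e'.2.2 = 0) = v)) : ℝ)))
  have S2 : entropySum (udata [] t) (fun _ => false) (fun e => decide (e.2.2 = 0)) = _ :=
    aux_sum_bool (udata [] t) (fun _ => false) (fun e => decide (e.2.2 = 0)) (fun b v =>
      Real.logb 2 (((udata [] t).countP (fun e' => decide (false = b)) : ℝ) /
        ((udata [] t).countP (fun e' => decide (false = b ∧ decide (e'.2.2 = 0) = v)) : ℝ)))
  simp only [aux_count_split D (fun e => lastBit e.1) (fun e => decide (e.2.2 = 0))] at S1
  have S2' := aux_count_split (udata [] t) (fun _ => false) (fun e => decide (e.2.2 = 0)) false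
  have uf : ∀ v, (udata [] t).countP (fun e' => decide (True ∧ decide (e'.2.2 = 0) = v)) =
    uc v (udata [] t) := by intro v; simp [uc]
  have ut : ∀ v, (udata [] t).countP (fun e' => decide (false = true ∧ decide (e'.2.2 = 0) = v)) =
    0 := by intro v; simp
  simp only [uf] at S2'
  simp only [uf, ut, S2'] at S2
  have bf : ∀ b v, D.countP (fun e => decide (lastBit e.1 = b ∧ decide (e.2.2 = 0) = v)) = bc b v D :=
    fun _ _ => rfl
  simp only [bf] at S1
  have hsz : sizeU t = uc false (udata [] t) + uc true (udata [] t) := by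
    rw [← S2']; simp [sizeU]
  have hm : 1 ≤ uc false (udata [] t) := by
    obtain ⟨a, f⟩ := t
    cases f with
    | nil => simp [sizeU, udata, fudata] at ht
    | cons s f => simp [udata, uc_cons, UForest.len]
  have hl : 1 ≤ uc true (udata [] t) := by omega
  generalize uc true (udata [] t) = l at *
  generalize uc false (udata [] t) = m at *
  have c4 : ((bc true false D : ℕ) : ℝ) = l - 1 := by
    have : ((bc true false D + 1 : ℕ) : ℝ) = l := by rw [H4]
    push_cast at this; linarith
  rw [H1, H2, H3] at S1
  push_cast at S1 S2
  rw [c4] at S1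
  have R := aux_real l m (by exact_mod_cast hl) (by exact_mod_cast hm)
  rw [hsz]
  push_cast
  rw [S1] at U1
  rw [S2] at U2
  simp only [zero_mul, add_zero] at U2
  linarith
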